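/- Let n ≥ 1, s ∈ (0,1), 1 < p⁻ ≤ p⁺ < ∞ with s·p⁺ < n, let λ > 0, and let Ω ⊂ ℝⁿ be open and bounded. There exists ε₀ > 0, depending only on n, s, p⁻, p⁺ and λ, such that for every Young function G satisfying condition (cond) with exponents p⁻, p⁺ and normalized by G(1)=1, every weak solution u ∈ W^{s,G}_0(Ω) of (−Δ_g)^s u = λ g(u) in Ω, u = 0 in ℝⁿ∖Ω, with ∫_Ω G(|u|)dx ≤ ε₀ satisfies |u| ≤ 1 a.e. in Ω. -/

import Mathlib

open MeasureTheory Real Set Filter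
open scoped ENNReal

noncomputable section

/-- A Young function `G` together with its right-continuous density `g`:
`G t = ∫₀ᵗ g(τ) dτ` for `t ≥ 0`, where `g` is right-continuous, nondecreasing on `[0,∞)`,
`g 0 = 0`, `g t > 0` for `t > 0` and `g t → ∞` as `t → ∞`.  `G` is extended evenly
(`G (-t) = G t`) and `g` oddly (`g (-t) = -g t`). -/
structure YoungPair where
  g : ℝ → ℝ
  G : ℝ → ℝ
  g_odd : ∀ t, g (-t) = -g t
  g_zero : g 0 = 0
  g_pos : ∀ t : ℝ, 0 < t → 0 < g t
  g_mono : MonotoneOn g (Set.Ici 0)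
  g_rightCont : ∀ t ∈ Set.Ici (0 : ℝ), ContinuousWithinAt g (Set.Ici t) t
  g_atTop : Filter.Tendsto g Filter.atTop Filter.atTop
  G_even : ∀ t, G (-t) = G t
  G_eq : ∀ t : ℝ, 0 ≤ t → G t = ∫ τ in (0 : ℝ)..t, g τ

/-- Condition (cond): `p⁻ ≤ t·g(t)/G(t) ≤ p⁺` for all `t > 0`. -/
def YoungPair.Cond (Y : YoungPair) (pm pp : ℝ) : Prop :=
  ∀ t : ℝ, 0 < t → pm * Y.G t ≤ t * Y.g t ∧ t * Y.g t ≤ pp * Y.G t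

/-- Euclidean space `ℝⁿ`. -/
abbrev Euc (n : ℕ) := EuclideanSpace ℝ (Fin n)

/-- The `s`-Hölder quotient `D_s u(x,y) = (u x - u y)/|x-y|^s`. -/
def Ds (n : ℕ) (s : ℝ) (u : Euc n → ℝ) (x y : Euc n) : ℝ :=
  (u x - u y) / ‖x - y‖ ^ s

/-- The modular `Φ_G(u) = ∫_Ω G(|u|) dx` (as an extended real). -/
def modG (n : ℕ) (G : ℝ → ℝ) (Ω : Set (Euc n)) (u : Euc n → ℝ) : ℝ≥0∞ :=
  ∫⁻ x in Ω, ENNReal.ofReal (G |u x|)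

/-- The Gagliardo modular `Φ_{s,G}(u) = ∬ G(|D_s u(x,y)|) dx dy/|x-y|ⁿ`
(as an extended real). -/
def modsG (n : ℕ) (s : ℝ) (G : ℝ → ℝ) (u : Euc n → ℝ) : ℝ≥0∞ :=
  ∫⁻ p : Euc n × Euc n, ENNReal.ofReal (G |Ds n s u p.1 p.2| / ‖p.1 - p.2‖ ^ (n : ℝ))

/-- Membership in `W^{s,G}_0(Ω)`: measurable, finite modulars, vanishing a.e. outside `Ω`. -/
def MemW0 (n : ℕ) (s : ℝ) (G : ℝ → ℝ) (Ω : Set (Euc n)) (u : Euc n → ℝ) : Prop :=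
  Measurable u ∧ modG n G Ω u + modsG n s G u < ⊤ ∧
    ∀ᵐ x : Euc n ∂volume, x ∉ Ω → u x = 0

/-- `u` is a weak solution of `(-Δ_g)^s u = rhs(u)` in `Ω`, `u = 0` in `ℝⁿ ∖ Ω`:
for every `v ∈ W^{s,G}_0(Ω)` the defining double integral converges absolutely and equals
`∫_Ω rhs(u) v dx`. -/
def IsWeakSol (n : ℕ) (s : ℝ) (Y : YoungPair) (Ω : Set (Euc n)) (rhs : ℝ → ℝ)
    (u : Euc n → ℝ) : Prop :=
  MemW0 n s Y.G Ω u ∧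
  ∀ v : Euc n → ℝ, MemW0 n s Y.G Ω v →
    MeasureTheory.Integrable (fun p : Euc n × Euc n =>
      Y.g (Ds n s u p.1 p.2) * (v p.1 - v p.2) / ‖p.1 - p.2‖ ^ ((n : ℝ) + s)) ∧
    (∫ p : Euc n × Euc n,
        Y.g (Ds n s u p.1 p.2) * (v p.1 - v p.2) / ‖p.1 - p.2‖ ^ ((n : ℝ) + s)) =
      ∫ x in Ω, rhs (u x) * v x

/-- The Luxemburg norm `‖u‖_{L^Ψ(Ω)}` (with value `∞` when no admissible `λ` exists). -/
def luxNorm (n : ℕ) (Ψ : ℝ → ℝ) (Ω : Set (Euc n)) (u : Euc n → ℝ) : ℝ≥0∞ :=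
  sInf {lam : ℝ≥0∞ | 0 < lam ∧ lam ≠ ⊤ ∧
    (∫⁻ x in Ω, ENNReal.ofReal (Ψ (|u x| / lam.toReal))) ≤ 1}

/-- The Gagliardo seminorm `[u]_{s,G}` (with value `∞` when no admissible `λ` exists). -/
def gagSemi (n : ℕ) (s : ℝ) (G : ℝ → ℝ) (u : Euc n → ℝ) : ℝ≥0∞ :=
  sInf {lam : ℝ≥0∞ | 0 < lam ∧ lam ≠ ⊤ ∧
    modsG n s G (fun x => u x / lam.toReal) ≤ 1}


namespace YoungPair

variable (Y : YoungPair)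

lemma intervalIntegrable_g {a b : ℝ} (ha : 0 ≤ a) (hb : 0 ≤ b) :
    IntervalIntegrable Y.g volume a b :=
  (Y.g_mono.mono fun _ hx => (le_min ha hb).trans hx.1).intervalIntegrable

lemma g_nonneg {t : ℝ} (ht : 0 ≤ t) : 0 ≤ Y.g t := by
  rcases ht.eq_or_lt with rfl | h
  · exact Y.g_zero.ge
  · exact (Y.g_pos t h).le

lemma G_zero : Y.G 0 = 0 := by
  simp [Y.G_eq 0 le_rfl]

lemma G_sub {a b : ℝ} (ha : 0 ≤ a) (hb : 0 ≤ b) : Y.G b - Y.G a = ∫ τ in a..b, Y.g τ := by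
  rw [Y.G_eq a ha, Y.G_eq b hb]
  exact intervalIntegral.integral_interval_sub_left (Y.intervalIntegrable_g le_rfl hb)
    (Y.intervalIntegrable_g le_rfl ha)

lemma G_le {a b : ℝ} (ha : 0 ≤ a) (hab : a ≤ b) : Y.G a ≤ Y.G b := by
  rw [← sub_nonneg, Y.G_sub ha (ha.trans hab)]
  exact intervalIntegral.integral_nonneg hab fun x hx => Y.g_nonneg (ha.trans hx.1)

lemma G_nonneg {t : ℝ} (ht : 0 ≤ t) : 0 ≤ Y.G t :=
  Y.G_zero.ge.trans (Y.G_le le_rfl ht)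

lemma measurable_G_abs : Measurable fun t : ℝ => Y.G |t| := by
  have h : Monotone fun t : ℝ => Y.G (max t 0) := fun a b hab =>
    Y.G_le (le_max_right _ _) (max_le_max_right _ hab)
  have h2 : (fun t : ℝ => Y.G |t|) = fun t : ℝ => Y.G (max |t| 0) := by
    funext t
    rw [max_eq_left (abs_nonneg t)]
  rw [h2]
  exact h.measurable.comp measurable_abs

lemma measurable_ofReal_G_abs {α : Type*} [MeasurableSpace α] {w : α → ℝ} (hw : Measurable w) :
    Measurable fun x => ENNReal.ofReal (Y.G |w x|) :=
  (Y.measurable_G_abs.comp hw).ennreal_ofReal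

lemma mul_G_le {c t : ℝ} (hc : 1 ≤ c) (ht : 0 ≤ t) : c * Y.G t ≤ Y.G (c * t) := by
  have hc0 : 0 ≤ c := zero_le_one.trans hc
  have h := intervalIntegral.mul_integral_comp_mul_left (a := 0) (b := t) (f := Y.g) (c := c)
  rw [mul_zero] at h
  rw [Y.G_eq (c * t) (by positivity), ← h, Y.G_eq t ht]
  have hmono : MonotoneOn (fun x => Y.g (c * x)) (Set.Ici 0) := fun x hx y hy hxy =>
    Y.g_mono (mul_nonneg hc0 hx) (mul_nonneg hc0 hy) (mul_le_mul_of_nonneg_left hxy hc0)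
  have hint : IntervalIntegrable (fun x => Y.g (c * x)) volume 0 t :=
    (hmono.mono fun x hx => (le_min le_rfl ht).trans hx.1).intervalIntegrable
  refine mul_le_mul_of_nonneg_left ?_ hc0
  refine intervalIntegral.integral_mono_on ht (Y.intervalIntegrable_g le_rfl ht) hint ?_
  intro x hx
  exact Y.g_mono hx.1 (mul_nonneg hc0 hx.1) (le_mul_of_one_le_left hx.1 hc)

variable {Y} {pm pp : ℝ}

lemma Cond.mul_g_le (h : Y.Cond pm pp) {t : ℝ} (ht : 0 ≤ t) : t * Y.g t ≤ pp * Y.G t := by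
  rcases ht.eq_or_lt with rfl | ht
  · simp [Y.G_zero]
  · exact (h t ht).2

lemma Cond.G_le_mul_g (h : Y.Cond pm pp) (hpm : 1 < pm) {t : ℝ} (ht : 0 ≤ t) :
    Y.G t ≤ t * Y.g t := by
  rcases ht.eq_or_lt with rfl | ht
  · simp [Y.G_zero]
  · exact (le_mul_of_one_le_left (Y.G_nonneg ht.le) hpm.le).trans (h t ht).1

lemma Cond.G_pos (h : Y.Cond pm pp) (hpp : 0 < pp) {t : ℝ} (ht : 0 < t) : 0 < Y.G t :=
  pos_of_mul_pos_right ((mul_pos ht (Y.g_pos t ht)).trans_le (h t ht).2) hpp.le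

lemma Cond.G_mul_le_two_mul (h : Y.Cond pm pp) (hpp : 0 < pp) {t : ℝ} (ht : 0 ≤ t) :
    Y.G ((1 + 1 / (2 * pp)) * t) ≤ 2 * Y.G t := by
  set δ := 1 / (2 * pp) with hδ
  have hδ0 : 0 < δ := by positivity
  have hat : 0 ≤ (1 + δ) * t := by positivity
  have hle : t ≤ (1 + δ) * t := by nlinarith
  have h1 : Y.G ((1 + δ) * t) - Y.G t ≤ δ * (t * Y.g ((1 + δ) * t)) := by
    rw [Y.G_sub ht hat]
    calc ∫ τ in t..(1 + δ) * t, Y.g τ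
        ≤ ∫ _ in t..(1 + δ) * t, Y.g ((1 + δ) * t) :=
          intervalIntegral.integral_mono_on hle (Y.intervalIntegrable_g ht hat)
            intervalIntegrable_const fun x hx => Y.g_mono (ht.trans hx.1) hat hx.2
      _ = δ * (t * Y.g ((1 + δ) * t)) := by
          rw [intervalIntegral.integral_const, smul_eq_mul]
          ring
  have h2 : t * Y.g ((1 + δ) * t) ≤ pp * Y.G ((1 + δ) * t) :=
    (mul_le_mul_of_nonneg_right hle (Y.g_nonneg hat)).trans (h.mul_g_le hat)
  have h3 : δ * (t * Y.g ((1 + δ) * t)) ≤ δ * (pp * Y.G ((1 + δ) * t)) :=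
    mul_le_mul_of_nonneg_left h2 hδ0.le
  have h4 : δ * (pp * Y.G ((1 + δ) * t)) = Y.G ((1 + δ) * t) / 2 := by
    rw [hδ]
    field_simp
  linarith

/-- A doubling constant, depending only on the upper exponent. -/
def doublingConst (pp : ℝ) : ℝ := 2 ^ ⌈2 * pp⌉₊

lemma two_le_doublingConst (hpp : 0 < pp) : 2 ≤ doublingConst pp := by
  refine le_self_pow₀ one_le_two ?_
  exact (Nat.ceil_pos.2 (by positivity)).ne'

lemma Cond.G_two_mul_le (h : Y.Cond pm pp) (hpp : 0 < pp) {t : ℝ} (ht : 0 ≤ t) :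
    Y.G (2 * t) ≤ doublingConst pp * Y.G t := by
  set a := 1 + 1 / (2 * pp) with ha
  have ha0 : 0 < a := by positivity
  have hiter : ∀ j : ℕ, Y.G (a ^ j * t) ≤ 2 ^ j * Y.G t := by
    intro j
    induction j with
    | zero => simp
    | succ j ih =>
      have := h.G_mul_le_two_mul hpp (t := a ^ j * t) (by positivity)
      rw [← ha, ← mul_assoc, ← pow_succ'] at this
      rw [pow_succ' (2 : ℝ)]
      linarith
  have h2 : 2 ≤ a ^ ⌈2 * pp⌉₊ := by
    have hb := one_add_mul_le_pow (a := 1 / (2 * pp)) (by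
      have : 0 < 1 / (2 * pp) := by positivity
      linarith) ⌈2 * pp⌉₊
    have hc : 1 ≤ (⌈2 * pp⌉₊ : ℝ) * (1 / (2 * pp)) := by
      rw [mul_one_div, one_le_div (by positivity)]
      exact Nat.le_ceil _
    linarith
  exact (Y.G_le (by positivity) (mul_le_mul_of_nonneg_right h2 ht)).trans (hiter _)

lemma Cond.G_two_pow_mul_le (h : Y.Cond pm pp) (hpp : 0 < pp) {t : ℝ} (ht : 0 ≤ t) (j : ℕ) :
    Y.G (2 ^ j * t) ≤ doublingConst pp ^ j * Y.G t := by
  induction j with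
  | zero => simp
  | succ j ih =>
    have h1 := h.G_two_mul_le hpp (t := 2 ^ j * t) (by positivity)
    have hK : 0 ≤ doublingConst pp := zero_le_two.trans (two_le_doublingConst hpp)
    rw [pow_succ', mul_assoc, pow_succ', mul_assoc]
    exact h1.trans (mul_le_mul_of_nonneg_left ih hK)

end YoungPair

lemma measurable_modsG_integrand (n : ℕ) (s : ℝ) (Y : YoungPair) {w : Euc n → ℝ}
    (hw : Measurable w) :
    Measurable fun p : Euc n × Euc n =>
      ENNReal.ofReal (Y.G |Ds n s w p.1 p.2| / ‖p.1 - p.2‖ ^ (n : ℝ)) := by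
  have hnorm : Measurable fun p : Euc n × Euc n => ‖p.1 - p.2‖ :=
    (measurable_fst.sub measurable_snd).norm
  have hDs : Measurable fun p : Euc n × Euc n => Ds n s w p.1 p.2 :=
    ((hw.comp measurable_fst).sub (hw.comp measurable_snd)).div (hnorm.pow_const s)
  exact ((Y.measurable_G_abs.comp hDs).div (hnorm.pow_const _)).ennreal_ofReal

lemma volume_ball_eq (n : ℕ) (x : Euc n) {r : ℝ} (hr : 0 < r) :
    volume (Metric.ball x r) =
      ENNReal.ofReal (r ^ n * volume.real (Metric.ball (0 : Euc n) 1)) := by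
  rw [Measure.addHaar_ball_of_pos volume x hr, finrank_euclideanSpace, Fintype.card_fin,
    ENNReal.ofReal_mul (by positivity), ofReal_measureReal measure_ball_lt_top.ne]

lemma volume_real_ball_pos (n : ℕ) : 0 < volume.real (Metric.ball (0 : Euc n) 1) :=
  ENNReal.toReal_pos (Metric.measure_ball_pos volume _ one_pos).ne' measure_ball_lt_top.ne

/-- Fibrewise modular Poincaré inequality for functions with small support. -/
lemma ofReal_G_mul_le_lintegral (n : ℕ) {s : ℝ} (hs : 0 < s) (Y : YoungPair)
    {w : Euc n → ℝ} (hw : Measurable w) {r : ℝ} (hr : 0 < r) (hr1 : r ≤ 1)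
    (hvol : 2 * volume {x | w x ≠ 0} ≤ volume (Metric.ball (0 : Euc n) r)) (x : Euc n) :
    ENNReal.ofReal (volume.real (Metric.ball (0 : Euc n) 1) / (2 * r ^ s)) *
        ENNReal.ofReal (Y.G |w x|) ≤
      ∫⁻ y, ENNReal.ofReal (Y.G |Ds n s w x y| / ‖x - y‖ ^ (n : ℝ)) := by
  by_cases hx : w x = 0
  · simp [hx, Y.G_zero]
  set κ := volume.real (Metric.ball (0 : Euc n) 1)
  have hκ : 0 < κ := volume_real_ball_pos n
  set A := {x | w x ≠ 0}
  set S := Metric.ball x r \ A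
  have hA : MeasurableSet A := hw (measurableSet_singleton 0).compl
  have hS : MeasurableSet S := Metric.isOpen_ball.measurableSet.diff hA
  have hrs : 0 < r ^ s := rpow_pos_of_pos hr s
  have hrs1 : r ^ s ≤ 1 := rpow_le_one hr.le hr1 hs.le
  have hball : volume (Metric.ball x r) ≤ 2 * volume S := by
    have h0 : volume (Metric.ball (0 : Euc n) r) = volume (Metric.ball x r) := by
      rw [volume_ball_eq n _ hr, volume_ball_eq n _ hr]
    rw [h0] at hvol
    have h1 : volume (Metric.ball x r) ≤ volume A + volume S :=
      (measure_mono fun y hy => by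
        by_cases hyA : y ∈ A
        · exact Or.inl hyA
        · exact Or.inr ⟨hy, hyA⟩).trans (measure_union_le A S)
    have h2 : volume (Metric.ball x r) + volume (Metric.ball x r) ≤
        volume (Metric.ball x r) + 2 * volume S := by
      calc volume (Metric.ball x r) + volume (Metric.ball x r)
          ≤ (volume A + volume S) + (volume A + volume S) := add_le_add h1 h1
        _ = 2 * volume A + 2 * volume S := by ring
        _ ≤ _ := add_le_add_left hvol _
    exact (ENNReal.add_le_add_iff_left measure_ball_lt_top.ne).1 h2
  have hpt : ∀ y ∈ S, ENNReal.ofReal (Y.G |w x| / r ^ s / r ^ n) ≤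
      ENNReal.ofReal (Y.G |Ds n s w x y| / ‖x - y‖ ^ (n : ℝ)) := by
    intro y hy
    have hwy : w y = 0 := not_not.1 hy.2
    have hxy : x ≠ y := fun h => hx (h ▸ hwy)
    have hpos : 0 < ‖x - y‖ := norm_pos_iff.2 (sub_ne_zero.2 hxy)
    have hlt : ‖x - y‖ ≤ r := by
      have := Metric.mem_ball.1 hy.1
      rw [dist_comm, dist_eq_norm] at this
      exact this.le
    have hps : 0 < ‖x - y‖ ^ s := rpow_pos_of_pos hpos s
    refine ENNReal.ofReal_le_ofReal ?_
    rw [rpow_natCast]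
    have h1 : Y.G |w x| / r ^ s ≤ Y.G |Ds n s w x y| := by
      have h2 : |Ds n s w x y| = |w x| / ‖x - y‖ ^ s := by
        rw [Ds, hwy, sub_zero, abs_div, abs_of_pos hps]
      have h3 := Y.mul_G_le (c := (r ^ s)⁻¹) ((one_le_inv₀ hrs).2 hrs1) (abs_nonneg (w x))
      rw [h2, div_eq_inv_mul]
      refine h3.trans (Y.G_le (by positivity) ?_)
      rw [← div_eq_inv_mul]
      exact div_le_div_of_nonneg_left (abs_nonneg _) hps (rpow_le_rpow hpos.le hlt hs.le)
    exact div_le_div₀ (Y.G_nonneg (abs_nonneg _)) h1 (pow_pos hpos n)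
      (pow_le_pow_left₀ hpos.le hlt n)
  have hG : 0 ≤ Y.G |w x| := Y.G_nonneg (abs_nonneg _)
  have hhalf : ENNReal.ofReal (r ^ n * κ / 2) ≤ volume S := by
    rw [volume_ball_eq n x hr] at hball
    rw [ENNReal.ofReal_div_of_pos two_pos, ENNReal.ofReal_ofNat]
    exact ENNReal.div_le_of_le_mul' hball
  calc ENNReal.ofReal (κ / (2 * r ^ s)) * ENNReal.ofReal (Y.G |w x|)
      = ENNReal.ofReal (Y.G |w x| / r ^ s / r ^ n) * ENNReal.ofReal (r ^ n * κ / 2) := by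
        rw [← ENNReal.ofReal_mul (by positivity), ← ENNReal.ofReal_mul (by positivity)]
        congr 1
        field_simp
    _ ≤ ENNReal.ofReal (Y.G |w x| / r ^ s / r ^ n) * volume S := by gcongr
    _ = ∫⁻ _ in S, ENNReal.ofReal (Y.G |w x| / r ^ s / r ^ n) := by
        rw [setLIntegral_const]
    _ ≤ ∫⁻ y in S, ENNReal.ofReal (Y.G |Ds n s w x y| / ‖x - y‖ ^ (n : ℝ)) :=
        setLIntegral_mono' hS hpt
    _ ≤ _ := setLIntegral_le_lintegral _ _

/-- Modular Poincaré inequality: a function whose support is small compared with a ball of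
radius `r ≤ 1` has its `G`-modular controlled by `r ^ s` times its Gagliardo modular. -/
lemma lintegral_G_le_modsG (n : ℕ) {s : ℝ} (hs : 0 < s) (Y : YoungPair)
    {w : Euc n → ℝ} (hw : Measurable w) {r : ℝ} (hr : 0 < r) (hr1 : r ≤ 1)
    (hvol : 2 * volume {x | w x ≠ 0} ≤ volume (Metric.ball (0 : Euc n) r)) :
    ∫⁻ x, ENNReal.ofReal (Y.G |w x|) ≤
      ENNReal.ofReal (2 / volume.real (Metric.ball (0 : Euc n) 1) * r ^ s) *
        modsG n s Y.G w := by
  have hκ := volume_real_ball_pos n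
  set κ := volume.real (Metric.ball (0 : Euc n) 1)
  have hrs : 0 < r ^ s := rpow_pos_of_pos hr s
  have hle : ENNReal.ofReal (κ / (2 * r ^ s)) * ∫⁻ x, ENNReal.ofReal (Y.G |w x|) ≤
      modsG n s Y.G w := by
    rw [modsG, Measure.volume_eq_prod,
      lintegral_prod _ (measurable_modsG_integrand n s Y hw).aemeasurable,
      ← lintegral_const_mul _ (Y.measurable_ofReal_G_abs hw)]
    exact lintegral_mono fun x => ofReal_G_mul_le_lintegral n hs Y hw hr hr1 hvol x
  calc ∫⁻ x, ENNReal.ofReal (Y.G |w x|)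
      = ENNReal.ofReal (2 / κ * r ^ s) *
          (ENNReal.ofReal (κ / (2 * r ^ s)) * ∫⁻ x, ENNReal.ofReal (Y.G |w x|)) := by
        rw [← mul_assoc, ← ENNReal.ofReal_mul (by positivity)]
        have : 2 / κ * r ^ s * (κ / (2 * r ^ s)) = 1 := by field_simp
        rw [this, ENNReal.ofReal_one, one_mul]
    _ ≤ _ := by gcongr

/-- The truncation `(u - c)₊`. -/
def trunc {n : ℕ} (u : Euc n → ℝ) (c : ℝ) (x : Euc n) : ℝ := max (u x - c) 0

lemma trunc_nonneg {n : ℕ} (u : Euc n → ℝ) (c : ℝ) (x : Euc n) : 0 ≤ trunc u c x :=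
  le_max_right _ _

lemma abs_trunc_le {n : ℕ} (u : Euc n → ℝ) {c : ℝ} (hc : 0 ≤ c) (x : Euc n) :
    |trunc u c x| ≤ |u x| := by
  rw [abs_of_nonneg (trunc_nonneg u c x)]
  exact max_le (by linarith [le_abs_self (u x)]) (abs_nonneg _)

lemma measurable_trunc {n : ℕ} {u : Euc n → ℝ} (hu : Measurable u) (c : ℝ) :
    Measurable (trunc u c) :=
  (hu.sub_const c).max measurable_const

lemma trunc_sub_bounds {n : ℕ} (u : Euc n → ℝ) (c : ℝ) {x y : Euc n} (h : u y ≤ u x) :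
    0 ≤ trunc u c x - trunc u c y ∧ trunc u c x - trunc u c y ≤ u x - u y := by
  unfold trunc
  refine ⟨sub_nonneg.2 (max_le_max_right _ (by linarith)), ?_⟩
  rcases max_cases (u x - c) 0 with h1 | h1 <;> rcases max_cases (u y - c) 0 with h2 | h2 <;>
    linarith [h1.1, h2.1]

lemma abs_trunc_sub_le {n : ℕ} (u : Euc n → ℝ) (c : ℝ) (x y : Euc n) :
    |trunc u c x - trunc u c y| ≤ |u x - u y| := by
  have := abs_max_sub_max_le_abs (u x - c) (u y - c) 0
  simpa [trunc] using this

lemma MemW0.trunc {n : ℕ} {s : ℝ} {Y : YoungPair} {Ω : Set (Euc n)} {u : Euc n → ℝ}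
    (h : MemW0 n s Y.G Ω u) {c : ℝ} (hc : 0 ≤ c) : MemW0 n s Y.G Ω (trunc u c) := by
  refine ⟨measurable_trunc h.1 c, lt_of_le_of_lt (add_le_add ?_ ?_) h.2.1, ?_⟩
  · exact lintegral_mono fun x => ENNReal.ofReal_le_ofReal
      (Y.G_le (abs_nonneg _) (abs_trunc_le u hc x))
  · refine lintegral_mono fun p => ENNReal.ofReal_le_ofReal ?_
    refine div_le_div_of_nonneg_right (Y.G_le (abs_nonneg _) ?_) (by positivity)
    rw [Ds, Ds, abs_div, abs_div]
    exact div_le_div_of_nonneg_right (abs_trunc_sub_le u c _ _) (abs_nonneg _)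
  · filter_upwards [h.2.2] with x hx hxΩ
    simp [_root_.trunc, hx hxΩ, hc]

/-- Pointwise monotonicity of the truncated energy. -/
lemma G_Ds_trunc_le {n : ℕ} {s pm pp : ℝ} {Y : YoungPair} (hY : Y.Cond pm pp)
    (hpm : 1 < pm) (u : Euc n → ℝ) (c : ℝ) (x y : Euc n) :
    Y.G |Ds n s (trunc u c) x y| ≤ Y.g (Ds n s u x y) * Ds n s (trunc u c) x y := by
  have main : ∀ x y : Euc n, u y ≤ u x →
      Y.G |Ds n s (trunc u c) x y| ≤ Y.g (Ds n s u x y) * Ds n s (trunc u c) x y := by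
    intro x y h
    obtain ⟨h0, h1⟩ := trunc_sub_bounds u c h
    have hd : 0 ≤ ‖x - y‖ ^ s := by positivity
    have hb : 0 ≤ Ds n s (trunc u c) x y := div_nonneg h0 hd
    have hab : Ds n s (trunc u c) x y ≤ Ds n s u x y := div_le_div_of_nonneg_right h1 hd
    rw [abs_of_nonneg hb]
    refine (hY.G_le_mul_g hpm hb).trans ?_
    rw [mul_comm]
    exact mul_le_mul_of_nonneg_right (Y.g_mono hb (hb.trans hab) hab) hb
  rcases le_total (u y) (u x) with h | h
  · exact main x y h
  · have hneg : ∀ v : Euc n → ℝ, Ds n s v x y = -Ds n s v y x := fun v => by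
      rw [Ds, Ds, norm_sub_rev, ← neg_div, neg_sub]
    rw [hneg u, hneg (trunc u c), abs_neg, Y.g_odd, neg_mul_neg]
    exact main y x h

/-- Caccioppoli-type estimate obtained by testing the equation with `(u - c)₊`. -/
lemma IsWeakSol.modsG_trunc_le {n : ℕ} (hn : 1 ≤ n) {s pm pp : ℝ} (hs : 0 < s) {Y : YoungPair}
    (hY : Y.Cond pm pp) (hpm : 1 < pm) {Ω : Set (Euc n)} {rhs : ℝ → ℝ} {u : Euc n → ℝ}
    (h : IsWeakSol n s Y Ω rhs u) {c : ℝ} (hc : 0 ≤ c) (hrhs : ∀ t, 0 ≤ t → 0 ≤ rhs t) :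
    modsG n s Y.G (trunc u c) ≤ ∫⁻ x, ENNReal.ofReal (rhs (u x) * trunc u c x) := by
  obtain ⟨hint, heq⟩ := h.2 _ (h.1.trunc hc)
  have hker : ∀ p : Euc n × Euc n,
      Y.G |Ds n s (trunc u c) p.1 p.2| / ‖p.1 - p.2‖ ^ (n : ℝ) ≤
      Y.g (Ds n s u p.1 p.2) * (trunc u c p.1 - trunc u c p.2) /
        ‖p.1 - p.2‖ ^ ((n : ℝ) + s) := by
    intro p
    have h1 : Y.g (Ds n s u p.1 p.2) * (trunc u c p.1 - trunc u c p.2) /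
        ‖p.1 - p.2‖ ^ ((n : ℝ) + s) =
        Y.g (Ds n s u p.1 p.2) * Ds n s (trunc u c) p.1 p.2 / ‖p.1 - p.2‖ ^ (n : ℝ) := by
      rw [rpow_add_of_nonneg (norm_nonneg _) (by positivity) hs.le, Ds, Ds]
      rw [mul_div_assoc', div_div, mul_comm (‖p.1 - p.2‖ ^ s)]
    rw [h1]
    exact div_le_div_of_nonneg_right (G_Ds_trunc_le hY hpm u c _ _) (by positivity)
  have hker0 : ∀ p : Euc n × Euc n,
      0 ≤ Y.G |Ds n s (trunc u c) p.1 p.2| / ‖p.1 - p.2‖ ^ (n : ℝ) := fun p =>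
    div_nonneg (Y.G_nonneg (abs_nonneg _)) (by positivity)
  have hrhs0 : ∀ x, 0 ≤ rhs (u x) * trunc u c x := by
    intro x
    by_cases hx : 0 ≤ u x
    · exact mul_nonneg (hrhs _ hx) (trunc_nonneg u c x)
    · have : trunc u c x = 0 := max_eq_right (by linarith)
      rw [this, mul_zero]
  calc modsG n s Y.G (trunc u c)
      ≤ ∫⁻ p : Euc n × Euc n, ENNReal.ofReal
          (Y.g (Ds n s u p.1 p.2) * (trunc u c p.1 - trunc u c p.2) /
            ‖p.1 - p.2‖ ^ ((n : ℝ) + s)) :=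
        lintegral_mono fun p => ENNReal.ofReal_le_ofReal (hker p)
    _ = ENNReal.ofReal (∫ x in Ω, rhs (u x) * trunc u c x) := by
        rw [← heq, ofReal_integral_eq_lintegral_ofReal hint
          (Eventually.of_forall fun p => (hker0 p).trans (hker p))]
    _ = ‖∫ x in Ω, rhs (u x) * trunc u c x‖ₑ :=
        (Real.enorm_of_nonneg (integral_nonneg hrhs0)).symm
    _ ≤ ∫⁻ x in Ω, ‖rhs (u x) * trunc u c x‖ₑ := enorm_integral_le_lintegral_enorm _
    _ = ∫⁻ x in Ω, ENNReal.ofReal (rhs (u x) * trunc u c x) :=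
        lintegral_congr fun x => Real.enorm_of_nonneg (hrhs0 x)
    _ ≤ _ := setLIntegral_le_lintegral _ _

lemma IsWeakSol.neg {n : ℕ} {s lam : ℝ} {Y : YoungPair} {Ω : Set (Euc n)} {u : Euc n → ℝ}
    (h : IsWeakSol n s Y Ω (fun t => lam * Y.g t) u) :
    IsWeakSol n s Y Ω (fun t => lam * Y.g t) (-u) := by
  have hDs : ∀ x y, Ds n s (-u) x y = -Ds n s u x y := fun x y => by
    simp only [Ds, Pi.neg_apply]
    ring
  refine ⟨⟨h.1.1.neg, ?_, ?_⟩, fun v hv => ?_⟩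
  · have := h.1.2.1
    simpa only [modG, modsG, hDs, Pi.neg_apply, abs_neg] using this
  · filter_upwards [h.1.2.2] with x hx hxΩ
    simp [hx hxΩ]
  · obtain ⟨hint, heq⟩ := h.2 v hv
    simp only [hDs, Y.g_odd, Pi.neg_apply, neg_mul, neg_div, mul_neg, integral_neg]
    exact ⟨hint.neg, by rw [heq]⟩

/-- The De Giorgi truncation `(u - (1 - 2⁻ᵏ))₊`. -/
def levelTrunc {n : ℕ} (u : Euc n → ℝ) (k : ℕ) : Euc n → ℝ := trunc u (1 - (2 ^ k)⁻¹)

lemma levelTrunc_nonneg {n : ℕ} (u : Euc n → ℝ) (k : ℕ) (x : Euc n) : 0 ≤ levelTrunc u k x :=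
  trunc_nonneg _ _ _

lemma measurable_levelTrunc {n : ℕ} {u : Euc n → ℝ} (hu : Measurable u) (k : ℕ) :
    Measurable (levelTrunc u k) :=
  measurable_trunc hu _

lemma level_nonneg (k : ℕ) : (0 : ℝ) ≤ 1 - (2 ^ k)⁻¹ :=
  sub_nonneg.2 (inv_le_one_of_one_le₀ (one_le_pow₀ one_le_two))

lemma levelTrunc_succ_ne_zero {n : ℕ} {u : Euc n → ℝ} {k : ℕ} {x : Euc n}
    (h : levelTrunc u (k + 1) x ≠ 0) :
    1 ≤ 2 ^ (k + 1) * levelTrunc u k x ∧ 0 ≤ u x ∧ u x ≤ 2 ^ (k + 2) * levelTrunc u k x := by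
  have hpos : (1 : ℝ) - (2 ^ (k + 1))⁻¹ < u x := by
    by_contra hle
    exact h (max_eq_right (by linarith))
  have hk : u x - (1 - (2 ^ k)⁻¹) ≤ levelTrunc u k x := le_max_left _ _
  have hp : (0 : ℝ) < 2 ^ k := by positivity
  have hhalf : ((2 : ℝ) ^ (k + 1))⁻¹ = (2 ^ k)⁻¹ / 2 := by
    rw [pow_succ, mul_inv, div_eq_mul_inv]
  have hmul : (2 : ℝ) ^ (k + 1) * (2 ^ (k + 1))⁻¹ = 1 := mul_inv_cancel₀ (by positivity)
  have hlow : ((2 : ℝ) ^ (k + 1))⁻¹ ≤ levelTrunc u k x := by linarith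
  have h1 : 1 ≤ 2 ^ (k + 1) * levelTrunc u k x := by
    rw [← hmul]
    exact mul_le_mul_of_nonneg_left hlow (by positivity)
  have h2 : levelTrunc u k x ≤ 2 ^ (k + 1) * levelTrunc u k x :=
    le_mul_of_one_le_left (levelTrunc_nonneg _ _ _) (one_le_pow₀ one_le_two)
  refine ⟨h1, (level_nonneg (k + 1)).trans hpos.le, ?_⟩
  have h3 : (2 : ℝ) ^ (k + 2) * levelTrunc u k x = 2 * (2 ^ (k + 1) * levelTrunc u k x) := by
    ring
  have h4 : (0 : ℝ) < (2 ^ k)⁻¹ := by positivity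
  linarith

section Iteration

variable {n : ℕ} {s pm pp lam : ℝ} {Y : YoungPair} {Ω : Set (Euc n)} {u : Euc n → ℝ}

lemma volume_levelTrunc_succ_le (hY : Y.Cond pm pp) (hpp : 0 < pp) (hG1 : Y.G 1 = 1)
    (hu : Measurable u) (k : ℕ) :
    volume {x | levelTrunc u (k + 1) x ≠ 0} ≤
      ENNReal.ofReal (YoungPair.doublingConst pp ^ (k + 1)) *
        ∫⁻ x, ENNReal.ofReal (Y.G |levelTrunc u k x|) := by
  have hK : 0 ≤ YoungPair.doublingConst pp :=
    zero_le_two.trans (YoungPair.two_le_doublingConst hpp)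
  have hA : MeasurableSet {x | levelTrunc u (k + 1) x ≠ 0} :=
    measurable_levelTrunc hu _ (measurableSet_singleton 0).compl
  rw [← lintegral_indicator_one hA, ← lintegral_const_mul _
    (Y.measurable_ofReal_G_abs (measurable_levelTrunc hu _))]
  refine lintegral_mono fun x => ?_
  by_cases hx : levelTrunc u (k + 1) x ≠ 0
  · rw [indicator_of_mem (by exact hx), Pi.one_apply, ← ENNReal.ofReal_mul (by positivity),
      ← ENNReal.ofReal_one, abs_of_nonneg (levelTrunc_nonneg _ _ _)]
    refine ENNReal.ofReal_le_ofReal ?_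
    rw [← hG1]
    exact (Y.G_le zero_le_one (levelTrunc_succ_ne_zero hx).1).trans
      (hY.G_two_pow_mul_le hpp (levelTrunc_nonneg _ _ _) _)
  · rw [indicator_of_notMem (by exact hx)]
    exact zero_le

lemma modsG_levelTrunc_succ_le (hn : 1 ≤ n) (hs : 0 < s) (hY : Y.Cond pm pp) (hpm : 1 < pm)
    (hpp : 0 < pp) (hlam : 0 < lam) (h : IsWeakSol n s Y Ω (fun t => lam * Y.g t) u) (k : ℕ) :
    modsG n s Y.G (levelTrunc u (k + 1)) ≤
      ENNReal.ofReal (lam * pp * YoungPair.doublingConst pp ^ (k + 2)) *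
        ∫⁻ x, ENNReal.ofReal (Y.G |levelTrunc u k x|) := by
  have hK : 0 ≤ YoungPair.doublingConst pp :=
    zero_le_two.trans (YoungPair.two_le_doublingConst hpp)
  refine (h.modsG_trunc_le hn hs hY hpm (level_nonneg (k + 1))
    fun t ht => mul_nonneg hlam.le (Y.g_nonneg ht)).trans ?_
  rw [← lintegral_const_mul _
    (Y.measurable_ofReal_G_abs (measurable_levelTrunc h.1.1 _))]
  refine lintegral_mono fun x => ?_
  rw [← ENNReal.ofReal_mul (by positivity)]
  refine ENNReal.ofReal_le_ofReal ?_
  have hG : 0 ≤ Y.G |levelTrunc u k x| := Y.G_nonneg (abs_nonneg _)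
  by_cases hx : levelTrunc u (k + 1) x = 0
  · have : trunc u (1 - (2 ^ (k + 1))⁻¹) x = 0 := hx
    simp only [this, mul_zero]
    positivity
  · obtain ⟨-, hu0, hule⟩ := levelTrunc_succ_ne_zero hx
    have htu : trunc u (1 - (2 ^ (k + 1))⁻¹) x ≤ u x :=
      max_le (by linarith [level_nonneg (k + 1)]) hu0
    have hw : 0 ≤ levelTrunc u k x := levelTrunc_nonneg _ _ _
    rw [abs_of_nonneg hw]
    calc lam * Y.g (u x) * trunc u (1 - (2 ^ (k + 1))⁻¹) x
        ≤ lam * Y.g (u x) * u x :=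
          mul_le_mul_of_nonneg_left htu (mul_nonneg hlam.le (Y.g_nonneg hu0))
      _ = lam * (u x * Y.g (u x)) := by ring
      _ ≤ lam * (pp * (YoungPair.doublingConst pp ^ (k + 2) * Y.G (levelTrunc u k x))) := by
          refine mul_le_mul_of_nonneg_left ((hY.mul_g_le hu0).trans ?_) hlam.le
          exact mul_le_mul_of_nonneg_left
            ((Y.G_le hu0 hule).trans (hY.G_two_pow_mul_le hpp hw _)) hpp.le
      _ = _ := by ring

lemma exists_iteration_scales (n : ℕ) (hs : 0 < s) {K D : ℝ} (hK : 1 ≤ K) (hD : 0 < D) :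
    ∃ ρ σ : ℝ, 0 < ρ ∧ ρ ≤ 1 ∧ 0 < σ ∧ σ ≤ 1 ∧ σ ^ s * K = 1 ∧ D * ρ ^ s ≤ σ ^ n / K := by
  have hK0 : 0 < K := one_pos.trans_le hK
  set σ := (K⁻¹) ^ s⁻¹ with hσ
  have hσ0 : 0 < σ := rpow_pos_of_pos (inv_pos.2 hK0) _
  set τ := σ ^ n / K / D with hτ
  have hτ0 : 0 < τ := by positivity
  refine ⟨min 1 (τ ^ s⁻¹), σ, lt_min one_pos (rpow_pos_of_pos hτ0 _), min_le_left _ _, hσ0,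
    rpow_le_one (inv_pos.2 hK0).le (inv_le_one_of_one_le₀ hK) (inv_pos.2 hs).le, ?_, ?_⟩
  · rw [hσ, rpow_inv_rpow (inv_pos.2 hK0).le hs.ne', inv_mul_cancel₀ hK0.ne']
  · have h1 : (min 1 (τ ^ s⁻¹)) ^ s ≤ τ := by
      refine (rpow_le_rpow (le_min zero_le_one (rpow_pos_of_pos hτ0 _).le)
        (min_le_right _ _) hs.le).trans_eq ?_
      exact rpow_inv_rpow hτ0.le hs.ne'
    calc D * (min 1 (τ ^ s⁻¹)) ^ s ≤ D * τ := mul_le_mul_of_nonneg_left h1 hD.le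
      _ = σ ^ n / K := by
        rw [hτ]
        field_simp

/-- Geometric decay of the modulars of the De Giorgi truncations. -/
lemma lintegral_levelTrunc_le (hn : 1 ≤ n) (hs : 0 < s) (hY : Y.Cond pm pp) (hpm : 1 < pm)
    (hpp : 0 < pp) (hlam : 0 < lam) (hG1 : Y.G 1 = 1)
    (h : IsWeakSol n s Y Ω (fun t => lam * Y.g t) u) {ρ σ κ K : ℝ}
    (hκ : κ = volume.real (Metric.ball (0 : Euc n) 1)) (hK : K = YoungPair.doublingConst pp)
    (hρ : 0 < ρ) (hρ1 : ρ ≤ 1) (hσ : 0 < σ) (hσ1 : σ ≤ 1) (hσK : σ ^ s * K = 1)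
    (hρD : 2 / κ * (lam * pp * K ^ 2) * ρ ^ s ≤ σ ^ n / K)
    (h0 : ∫⁻ x, ENNReal.ofReal (Y.G |levelTrunc u 0 x|) ≤
      ENNReal.ofReal (κ * ρ ^ n / (2 * K))) (k : ℕ) :
    ∫⁻ x, ENNReal.ofReal (Y.G |levelTrunc u k x|) ≤
      ENNReal.ofReal (κ * ρ ^ n / (2 * K) * (σ ^ n / K) ^ k) := by
  have hκ0 : 0 < κ := hκ ▸ volume_real_ball_pos n
  have hK0 : 0 < K := by
    rw [hK]
    exact two_pos.trans_le (YoungPair.two_le_doublingConst hpp)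
  induction k with
  | zero => simpa using h0
  | succ k ih =>
    have hr : 0 < ρ * σ ^ k := by positivity
    have hvol : 2 * volume {x | levelTrunc u (k + 1) x ≠ 0} ≤
        volume (Metric.ball (0 : Euc n) (ρ * σ ^ k)) := by
      have h1 := volume_levelTrunc_succ_le hY hpp hG1 h.1.1 k
      rw [← hK] at h1
      rw [volume_ball_eq n _ hr, ← hκ]
      calc 2 * volume {x | levelTrunc u (k + 1) x ≠ 0}
          ≤ ENNReal.ofReal 2 * (ENNReal.ofReal (K ^ (k + 1)) *
              ENNReal.ofReal (κ * ρ ^ n / (2 * K) * (σ ^ n / K) ^ k)) := by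
            rw [ENNReal.ofReal_ofNat]
            gcongr
            exact h1.trans (by gcongr)
        _ = ENNReal.ofReal ((ρ * σ ^ k) ^ n * κ) := by
            rw [← ENNReal.ofReal_mul (by positivity), ← ENNReal.ofReal_mul (by positivity)]
            congr 1
            rw [div_pow, mul_pow, ← pow_mul, ← pow_mul, mul_comm n k, pow_succ K]
            field_simp
    have h2 := lintegral_G_le_modsG n hs Y (measurable_levelTrunc h.1.1 _) hr
      (mul_le_one₀ hρ1 (by positivity) (pow_le_one₀ hσ.le hσ1)) hvol
    have h3 := modsG_levelTrunc_succ_le hn hs hY hpm hpp hlam h k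
    rw [← hK] at h3
    rw [← hκ] at h2
    calc ∫⁻ x, ENNReal.ofReal (Y.G |levelTrunc u (k + 1) x|)
        ≤ ENNReal.ofReal (2 / κ * (ρ * σ ^ k) ^ s) *
            (ENNReal.ofReal (lam * pp * K ^ (k + 2)) *
              ENNReal.ofReal (κ * ρ ^ n / (2 * K) * (σ ^ n / K) ^ k)) := by
          refine h2.trans ?_
          gcongr
          exact h3.trans (by gcongr)
      _ = ENNReal.ofReal (2 / κ * (lam * pp * K ^ 2) * ρ ^ s *
            (κ * ρ ^ n / (2 * K) * (σ ^ n / K) ^ k)) := by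
          rw [← ENNReal.ofReal_mul (by positivity), ← ENNReal.ofReal_mul (by positivity)]
          congr 1
          have h4 : (ρ * σ ^ k) ^ s * K ^ k = ρ ^ s := by
            rw [mul_rpow hρ.le (by positivity), ← rpow_natCast σ k, ← rpow_mul hσ.le,
              mul_comm (k : ℝ) s, rpow_mul hσ.le, rpow_natCast, mul_assoc, ← mul_pow, hσK,
              one_pow, mul_one]
          rw [← h4, pow_add]
          ring
      _ ≤ _ := by
          refine ENNReal.ofReal_le_ofReal ?_
          rw [pow_succ (σ ^ n / K) k]
          calc _ ≤ σ ^ n / K * (κ * ρ ^ n / (2 * K) * (σ ^ n / K) ^ k) :=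
                mul_le_mul_of_nonneg_right hρD (by positivity)
            _ = _ := by ring

/-- One-sided bound from geometric decay. -/
lemma ae_le_one_of_lintegral_levelTrunc_le (hY : Y.Cond pm pp) (hpp : 0 < pp)
    (hu : Measurable u) {ε θ : ℝ} (hθ : 0 ≤ θ) (hθ1 : θ < 1)
    (h : ∀ k, ∫⁻ x, ENNReal.ofReal (Y.G |levelTrunc u k x|) ≤ ENNReal.ofReal (ε * θ ^ k)) :
    ∀ᵐ x, u x ≤ 1 := by
  have hle : ∀ k, ∫⁻ x, ENNReal.ofReal (Y.G |trunc u 1 x|) ≤ ENNReal.ofReal (ε * θ ^ k) := by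
    refine fun k => (lintegral_mono fun x => ENNReal.ofReal_le_ofReal ?_).trans (h k)
    refine Y.G_le (abs_nonneg _) (le_trans ?_ (le_abs_self _))
    rw [abs_of_nonneg (trunc_nonneg _ _ _)]
    refine max_le_max_right _ ?_
    have : (0 : ℝ) < (2 ^ k)⁻¹ := by positivity
    linarith
  have hlim : Tendsto (fun k : ℕ => ENNReal.ofReal (ε * θ ^ k)) atTop (nhds 0) := by
    have := (tendsto_pow_atTop_nhds_zero_of_lt_one hθ hθ1).const_mul ε
    rw [mul_zero] at this
    simpa using ENNReal.tendsto_ofReal this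
  have hzero : ∫⁻ x, ENNReal.ofReal (Y.G |trunc u 1 x|) = 0 :=
    le_antisymm (ge_of_tendsto' hlim hle) zero_le
  rw [lintegral_eq_zero_iff (Y.measurable_ofReal_G_abs (measurable_trunc hu _))]
    at hzero
  filter_upwards [hzero] with x hx
  by_contra hlt
  have hpos : 0 < trunc u 1 x := lt_max_of_lt_left (by linarith)
  have hG : 0 < Y.G |trunc u 1 x| := hY.G_pos hpp (abs_pos.2 hpos.ne')
  exact hG.not_ge (ENNReal.ofReal_eq_zero.1 hx)

lemma lintegral_levelTrunc_zero_le (hΩ : MeasurableSet Ω) (hu : MemW0 n s Y.G Ω u) :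
    ∫⁻ x, ENNReal.ofReal (Y.G |levelTrunc u 0 x|) ≤
      ENNReal.ofReal (∫ x in Ω, Y.G |u x|) := by
  have hmeas : Measurable fun x => Y.G |u x| := Y.measurable_G_abs.comp hu.1
  have hnn : ∀ x, 0 ≤ Y.G |u x| := fun x => Y.G_nonneg (abs_nonneg _)
  have hfin : ∫⁻ x in Ω, ENNReal.ofReal (Y.G |u x|) < ⊤ := lt_of_le_of_lt le_self_add hu.2.1
  have hint : IntegrableOn (fun x => Y.G |u x|) Ω :=
    ⟨hmeas.aestronglyMeasurable,
      (hasFiniteIntegral_iff_ofReal (Eventually.of_forall hnn)).2 hfin⟩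
  rw [ofReal_integral_eq_lintegral_ofReal hint (Eventually.of_forall hnn),
    ← lintegral_indicator hΩ]
  refine lintegral_mono_ae ?_
  filter_upwards [hu.2.2] with x hx
  by_cases hxΩ : x ∈ Ω
  · rw [indicator_of_mem hxΩ]
    exact ENNReal.ofReal_le_ofReal
      (Y.G_le (abs_nonneg _) (abs_trunc_le u (level_nonneg 0) x))
  · have : levelTrunc u 0 x = 0 := by simp [levelTrunc, trunc, hx hxΩ]
    simp [this, Y.G_zero]

end Iteration

/-- smallness of the modular implies `|u| ≤ 1` a.e. in `Ω`. -/
theorem statement1 (n : ℕ) (hn : 1 ≤ n) (s : ℝ) (hs : s ∈ Set.Ioo (0 : ℝ) 1)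
    (pm pp : ℝ) (hpm : 1 < pm) (hpmpp : pm ≤ pp) (hspp : s * pp < n)
    (lam : ℝ) (hlam : 0 < lam) :
    ∃ ε₀ : ℝ, 0 < ε₀ ∧
      ∀ Ω : Set (Euc n), IsOpen Ω → Bornology.IsBounded Ω →
      ∀ Y : YoungPair, Y.Cond pm pp → Y.G 1 = 1 →
      ∀ u : Euc n → ℝ,
        IsWeakSol n s Y Ω (fun t => lam * Y.g t) u →
        (∫ x in Ω, Y.G |u x|) ≤ ε₀ →
        ∀ᵐ x : Euc n ∂volume, x ∈ Ω → |u x| ≤ 1 := by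
  have hs0 : 0 < s := hs.1
  have hpp : 0 < pp := by linarith
  set κ := volume.real (Metric.ball (0 : Euc n) 1) with hκ
  have hκ0 : 0 < κ := volume_real_ball_pos n
  set K := YoungPair.doublingConst pp with hK
  have hK2 : 2 ≤ K := YoungPair.two_le_doublingConst hpp
  have hK0 : 0 < K := by linarith
  obtain ⟨ρ, σ, hρ, hρ1, hσ, hσ1, hσK, hρD⟩ :=
    exists_iteration_scales n hs0 (K := K) (D := 2 / κ * (lam * pp * K ^ 2)) (by linarith)
      (by positivity)
  have hθ1 : σ ^ n / K < 1 := by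
    rw [div_lt_one hK0]
    linarith [pow_le_one₀ hσ.le hσ1 (n := n)]
  refine ⟨κ * ρ ^ n / (2 * K), by positivity, fun Ω hΩ _ Y hY hG1 u hu hsmall => ?_⟩
  have key : ∀ v : Euc n → ℝ, IsWeakSol n s Y Ω (fun t => lam * Y.g t) v →
      (∫ x in Ω, Y.G |v x|) ≤ κ * ρ ^ n / (2 * K) → ∀ᵐ x, v x ≤ 1 := fun v hv hvs =>
    ae_le_one_of_lintegral_levelTrunc_le hY hpp hv.1.1 (by positivity) hθ1 <|
      lintegral_levelTrunc_le hn hs0 hY hpm hpp hlam hG1 hv hκ hK hρ hρ1 hσ hσ1 hσK hρD <|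
        (lintegral_levelTrunc_zero_le hΩ.measurableSet hv.1).trans
          (ENNReal.ofReal_le_ofReal hvs)
  filter_upwards [key u hu hsmall, key (-u) hu.neg (by simpa using hsmall)] with x h1 h2 _
  exact abs_le.2 ⟨by linarith [show -u x ≤ 1 from h2], h1⟩

end
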